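/- Let S be a finite nonempty state space, let π and q be everywhere-positive probability mass functions on S, and let P be the transition matrix of the Metropolized independence sampler targeting π with proposal q. Set w* = min_{x∈S} q(x)/π(x) (equivalently, the reciprocal of the maximal importance ratio max_x π(x)/q(x)). Then for every starting state x ∈ S and every n ≥ 1, the total variation distance between the n-step distribution P^n(x,·) and π satisfies ‖P^n(x,·) − π‖_TV ≤ (1 − w*)^n. -/

import Mathlib

open Finset in
/-- Powers of a stochastic matrix satisfying a Doeblin minorization by a stationary distribution
split into a multiple of that distribution and a nonnegative remainder of geometric mass. -/
theorem Matrix.exists_pow_decomposition_of_minorization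
    {S : Type*} [Fintype S] [DecidableEq S] {P : Matrix S S ℝ} {μ : S → ℝ} {w : ℝ}
    (hrow : ∀ x, ∑ y, P x y = 1) (hsum : ∑ x, μ x = 1)
    (hstat : ∀ y, ∑ x, μ x * P x y = μ y) (hmin : ∀ x y, w * μ y ≤ P x y) (n : ℕ) :
    ∃ Q : Matrix S S ℝ, (∀ x y, 0 ≤ Q x y) ∧ (∀ x, ∑ y, Q x y = (1 - w) ^ n) ∧
      ∀ x y, (P ^ n) x y = (1 - (1 - w) ^ n) * μ y + Q x y := by
  induction n with
  | zero =>
    refine ⟨1, fun x y => ?_, fun x => ?_, fun x y => ?_⟩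
    · rw [Matrix.one_apply]
      split_ifs <;> norm_num
    · simp [Matrix.one_apply]
    · simp
  | succ n ih =>
    obtain ⟨Q, hQ, hQrow, hP⟩ := ih
    refine ⟨fun x y => ∑ z, Q x z * (P z y - w * μ y), fun x y => ?_, fun x => ?_, fun x y => ?_⟩
    · exact sum_nonneg fun z _ => mul_nonneg (hQ x z) (sub_nonneg.2 (hmin z y))
    · rw [sum_comm]
      simp_rw [← mul_sum, sum_sub_distrib, hrow, ← mul_sum, hsum, ← sum_mul, hQrow]
      ring
    · rw [pow_succ, Matrix.mul_apply]
      simp_rw [hP, add_mul, mul_sub, sum_add_distrib, sum_sub_distrib, mul_assoc, ← mul_sum,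
        hstat, ← sum_mul, hQrow]
      ring

open Finset in
/-- Geometric convergence in total variation under a Doeblin minorization by the stationary
distribution. -/
theorem Matrix.half_sum_abs_pow_sub_le_of_minorization
    {S : Type*} [Fintype S] [DecidableEq S] {P : Matrix S S ℝ} {μ : S → ℝ} {w : ℝ}
    (hrow : ∀ x, ∑ y, P x y = 1) (hμ : ∀ x, 0 ≤ μ x) (hsum : ∑ x, μ x = 1)
    (hstat : ∀ y, ∑ x, μ x * P x y = μ y) (hmin : ∀ x y, w * μ y ≤ P x y) (x : S) (n : ℕ) :
    (1 / 2) * ∑ y, |(P ^ n) x y - μ y| ≤ (1 - w) ^ n := by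
  obtain ⟨Q, hQ, hQrow, hP⟩ :=
    Matrix.exists_pow_decomposition_of_minorization hrow hsum hstat hmin n
  have hpow : 0 ≤ (1 - w) ^ n := hQrow x ▸ sum_nonneg fun y _ => hQ x y
  have hbound : ∑ y, |(P ^ n) x y - μ y| ≤ ∑ y, (Q x y + (1 - w) ^ n * μ y) := by
    refine sum_le_sum fun y _ => ?_
    have hmul := mul_nonneg hpow (hμ y)
    have hQxy := hQ x y
    rw [hP, abs_le]
    constructor <;> linarith
  rw [sum_add_distrib, hQrow, ← mul_sum, hsum] at hbound
  linarith

/-- The Metropolis flow of an independence sampler is symmetric in its two states. -/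
theorem mul_mul_min_one_div_eq {a b c d : ℝ} (ha : 0 < a) (hd : 0 < d) :
    a * (d * min 1 ((b * c) / (a * d))) = min (a * d) (b * c) := by
  have had : 0 < a * d := mul_pos ha hd
  rw [← mul_assoc, mul_min_of_nonneg _ _ had.le, mul_one, mul_div_cancel₀ _ had.ne']

/-- Let `S` be a finite nonempty state space, `π` and `q`
everywhere-positive probability mass functions on `S`, and `P` the transition
matrix of the Metropolized independence sampler targeting `π` with proposal
`q`: for `x ≠ y`, `P x y = q y * min 1 ((π y * q x) / (π x * q y))`, and
`P x x = 1 - ∑_{y ≠ x} P x y`.  Set `w* = min_{x ∈ S} q x / π x`.  Then for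
every starting state `x ∈ S` and every `n ≥ 1`, the total variation distance
`(1/2) · ∑_y |Pⁿ(x,y) − π y|` between the `n`-step distribution `Pⁿ(x,·)` and
`π` is at most `(1 − w*)ⁿ`. -/
theorem mis_total_variation_bound
    {S : Type*} [Fintype S] [DecidableEq S] [Nonempty S]
    (π q : S → ℝ)
    (hπpos : ∀ x, 0 < π x) (hqpos : ∀ x, 0 < q x)
    (hπsum : ∑ x, π x = 1) (hqsum : ∑ x, q x = 1)
    (P : Matrix S S ℝ)
    (hPoff : ∀ x y, x ≠ y → P x y = q y * min 1 ((π y * q x) / (π x * q y)))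
    (hPdiag : ∀ x, P x x = 1 - ∑ y ∈ Finset.univ.erase x, P x y) :
    ∀ (x : S) (n : ℕ), 1 ≤ n →
      (1 / 2) * ∑ y, |(P ^ n) x y - π y| ≤
        (1 - Finset.univ.inf' Finset.univ_nonempty (fun z => q z / π z)) ^ n := by
  intro x n _
  set w := Finset.univ.inf' Finset.univ_nonempty (fun z => q z / π z)
  have hwq : ∀ z, w * π z ≤ q z := fun z =>
    (le_div_iff₀ (hπpos z)).1 (Finset.inf'_le (fun z => q z / π z) (Finset.mem_univ z))
  have hflow : ∀ x y, x ≠ y → π x * P x y = min (π x * q y) (π y * q x) := fun x y hxy => by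
    rw [hPoff x y hxy, mul_mul_min_one_div_eq (hπpos x) (hqpos y)]
  have hrow : ∀ x, ∑ y, P x y = 1 := fun x => by
    rw [← Finset.add_sum_erase _ _ (Finset.mem_univ x), hPdiag x, sub_add_cancel]
  have hrev : ∀ x y, π x * P x y = π y * P y x := fun x y => by
    rcases eq_or_ne x y with rfl | hxy
    · rfl
    · rw [hflow x y hxy, hflow y x hxy.symm, min_comm]
  have hstat : ∀ y, ∑ x, π x * P x y = π y := fun y => by
    simp_rw [fun x => hrev x y, ← Finset.mul_sum, hrow, mul_one]
  have hmin : ∀ x y, w * π y ≤ P x y := fun x y => by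
    rcases eq_or_ne x y with rfl | hxy
    · have hle : ∑ y ∈ Finset.univ.erase x, P x y ≤ ∑ y ∈ Finset.univ.erase x, q y := by
        refine Finset.sum_le_sum fun y hy => ?_
        rw [hPoff x y (Finset.ne_of_mem_erase hy).symm]
        exact mul_le_of_le_one_right (hqpos y).le (min_le_left _ _)
      have hq := Finset.add_sum_erase _ q (Finset.mem_univ x)
      have hwx := hwq x
      rw [hPdiag x]
      linarith
    · refine le_of_mul_le_mul_left ?_ (hπpos x)
      rw [hflow x y hxy]
      refine le_min (mul_le_mul_of_nonneg_left (hwq y) (hπpos x).le) ?_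
      calc π x * (w * π y) = π y * (w * π x) := by ring
        _ ≤ π y * q x := mul_le_mul_of_nonneg_left (hwq x) (hπpos y).le
  exact Matrix.half_sum_abs_pow_sub_le_of_minorization hrow (fun z => (hπpos z).le) hπsum
    hstat hmin x n
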